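/- Let I be an admissible ideal on ℕ, let λ = (λ_i) and μ = (μ_i) be elements of Λ with λ_i ≤ μ_i for all i ∈ ℕ, and let α, β be fixed reals with 0 < α ≤ β ≤ 1. Suppose lim_{i→∞} μ_i / λ_i^β = 1. If a bounded real sequence x = (x_j) is I_λ-statistically convergent of order α to Z (i.e. for every ε > 0 and δ > 0, the set {i ∈ ℕ : λ_i^{−α} · |{j ∈ I_i : |x_j − Z| ≥ ε}| ≥ δ} ∈ I), then x is I_μ-summable of order β to Z (i.e. for every ε > 0, the set {i ∈ ℕ : μ_i^{−β} · Σ_{j ∈ J_i} |x_j − Z| ≥ ε} ∈ I). -/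

import Mathlib

open Filter Finset

/-- An admissible ideal on ℕ: contains all finite sets, closed under subsets and
finite unions, and does not contain ℕ itself. -/
def AdmissibleIdeal (I : Set (Set ℕ)) : Prop :=
  (∀ A : Set ℕ, A.Finite → A ∈ I) ∧
  (∀ A B : Set ℕ, A ∈ I → B ⊆ A → B ∈ I) ∧
  (∀ A B : Set ℕ, A ∈ I → B ∈ I → A ∪ B ∈ I) ∧
  (Set.univ : Set ℕ) ∉ I

/-- Membership in Λ: a nondecreasing sequence of positive integers with `l i ≤ i`. -/
def InLambda (l : ℕ → ℕ) : Prop :=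
  Monotone l ∧ (∀ i, 0 < l i) ∧ ∀ i, 1 ≤ i → l i ≤ i

/-- The generalized de la Vallée-Poussin window `I_i = [i − λ_i + 1, i] ∩ ℕ`. -/
def window (l : ℕ → ℕ) (i : ℕ) : Finset ℕ := Finset.Icc (i - l i + 1) i

open Classical in
/-- `I_λ`-statistical convergence of order `α` to `Z` (plain version). -/
def IStatConv (I : Set (Set ℕ)) (l : ℕ → ℕ) (α : ℝ) (x : ℕ → ℝ) (Z : ℝ) : Prop :=
  ∀ ε > (0:ℝ), ∀ δ > (0:ℝ),
    {i : ℕ | δ ≤ ((l i : ℝ) ^ (-α)) *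
      ((window l i).filter (fun j => ε ≤ |x j - Z|)).card} ∈ I

/-- `I_λ`-summability of order `α` to `Z` (plain version). -/
def ISumm (I : Set (Set ℕ)) (l : ℕ → ℕ) (α : ℝ) (x : ℕ → ℝ) (Z : ℝ) : Prop :=
  ∀ ε > (0:ℝ),
    {i : ℕ | ε ≤ ((l i : ℝ) ^ (-α)) * ∑ j ∈ window l i, |x j - Z|} ∈ I

lemma window_subset_window {l m : ℕ → ℕ} {i : ℕ} (h : l i ≤ m i) : window l i ⊆ window m i :=
  Finset.Icc_subset_Icc (by omega) le_rfl

lemma card_window {l : ℕ → ℕ} {i : ℕ} (h : l i ≤ i) : (window l i).card = l i := by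
  simp only [window, Nat.card_Icc]
  omega

open Classical in
lemma sum_le_card_mul_add_card_filter_mul {ι : Type*} (s : Finset ι) (f : ι → ℝ) {η M : ℝ}
    (hη : 0 ≤ η) (hM : ∀ j, f j ≤ M) :
    ∑ j ∈ s, f j ≤ s.card * η + (s.filter (fun j => η ≤ f j)).card * M := by
  have key : ∀ j ∈ s, f j ≤ η + if η ≤ f j then M else 0 := by
    intro j _
    split_ifs with h
    · linarith [hM j]
    · linarith
  refine (Finset.sum_le_sum key).trans_eq ?_
  rw [Finset.sum_add_distrib, ← Finset.sum_filter]
  simp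

open Classical in
lemma sum_window_le {l m : ℕ → ℕ} {i : ℕ} (hlm : l i ≤ m i) (hmi : m i ≤ i) (f : ℕ → ℝ)
    {η M : ℝ} (hη : 0 ≤ η) (hM : ∀ j, f j ≤ M) :
    ∑ j ∈ window m i, f j ≤
      ((m i : ℝ) - l i) * M + (l i * η + ((window l i).filter (fun j => η ≤ f j)).card * M) := by
  have hsub := window_subset_window hlm
  rw [← Finset.sum_sdiff hsub]
  refine add_le_add ?_ ?_
  · refine (Finset.sum_le_card_nsmul _ _ M fun j _ => hM j).trans_eq ?_
    rw [Finset.card_sdiff_of_subset hsub, card_window hmi, card_window (hlm.trans hmi),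
      nsmul_eq_mul, Nat.cast_sub hlm]
  · have h := sum_le_card_mul_add_card_filter_mul (window l i) f hη hM
    rwa [card_window (hlm.trans hmi)] at h

theorem statConv_implies_summable_of_tendsto_one
    (I : Set (Set ℕ)) (hI : AdmissibleIdeal I)
    (lam mu : ℕ → ℕ) (hlam : InLambda lam) (hmu : InLambda mu)
    (hle : ∀ i, lam i ≤ mu i)
    (α β : ℝ) (hα : 0 < α) (hαβ : α ≤ β) (hβ : β ≤ 1)
    (hlim : Filter.Tendsto (fun i => (mu i : ℝ) / (lam i : ℝ) ^ β) Filter.atTop (nhds 1))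
    (x : ℕ → ℝ) (Z : ℝ)
    (hbdd : ∃ K : ℝ, 0 < K ∧ ∀ j, |x j| ≤ K)
    (hx : IStatConv I lam α x Z) :
    ISumm I mu β x Z := by
  classical
  obtain ⟨hfin, hsub, hunion, -⟩ := hI
  obtain ⟨K, hK, hxK⟩ := hbdd
  intro ε hε
  set M : ℝ := K + |Z| with hMdef
  have hM : 0 < M := by positivity
  have hxM : ∀ j, |x j - Z| ≤ M := fun j => (abs_sub _ _).trans (by linarith [hxK j])
  have hev : ∀ᶠ i in atTop, (mu i : ℝ) / (lam i : ℝ) ^ β < 1 + min 1 (ε / (4 * M)) :=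
    hlim.eventually_lt_const (by simp; positivity)
  obtain ⟨N, hN⟩ := eventually_atTop.1 hev
  refine hsub _ _ (hunion _ _ (hfin _ (Set.finite_Iio (N + 1)))
    (hx (ε / 8) (by positivity) (ε / (4 * M)) (by positivity))) fun i hi => ?_
  by_contra hcon
  simp only [Set.mem_union, Set.mem_Iio, Set.mem_ofPred_eq, not_or, not_lt, not_le] at hcon hi
  obtain ⟨hNi, hstat⟩ := hcon
  have hratio := hN i (by omega)
  have hl1 : (1 : ℝ) ≤ lam i := by exact_mod_cast hlam.2.1 i
  have hlm : (lam i : ℝ) ≤ mu i := by exact_mod_cast hle i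
  have hl0 : (0 : ℝ) < lam i := by linarith
  have hsum := sum_window_le (hle i) (hmu.2.2 i (by omega)) (fun j => |x j - Z|)
    (by positivity : 0 ≤ ε / 8) hxM
  set c : ℝ := (((window lam i).filter (fun j => ε / 8 ≤ |x j - Z|)).card : ℝ) with hc
  have hc0 : 0 ≤ c := Nat.cast_nonneg _
  set p : ℝ := (lam i : ℝ) ^ (-β) with hp
  have hp0 : 0 < p := Real.rpow_pos_of_pos hl0 _
  have hmup : (mu i : ℝ) ^ (-β) ≤ p := Real.rpow_le_rpow_of_nonpos hl0 hlm (by linarith)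
  have hpα : p ≤ (lam i : ℝ) ^ (-α) := Real.rpow_le_rpow_of_exponent_le hl1 (by linarith)
  have hpl : 1 ≤ p * lam i := by
    have h : p * lam i = (lam i : ℝ) ^ (1 - β) := by
      rw [hp, ← Real.rpow_add_one hl0.ne', neg_add_eq_sub]
    rw [h]
    exact Real.one_le_rpow hl1 (by linarith)
  rw [div_eq_mul_inv, ← Real.rpow_neg hl0.le, ← hp] at hratio
  have hr1 : mu i * p < 2 := by linarith [min_le_left 1 (ε / (4 * M))]
  have hr2 : mu i * p - 1 < ε / (4 * M) := by linarith [min_le_right 1 (ε / (4 * M))]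
  have hpc : p * c < ε / (4 * M) := (mul_le_mul_of_nonneg_right hpα hc0).trans_lt hstat
  have hεM : ε / (4 * M) * M = ε / 4 := by field_simp
  have hbound : ε ≤ p * (((mu i : ℝ) - lam i) * M + (lam i * (ε / 8) + c * M)) :=
    hi.trans (mul_le_mul hmup hsum (Finset.sum_nonneg fun j _ => abs_nonneg _) hp0.le)
  have hgap : (mu i * p - p * lam i) * M ≤ ε / 4 := by
    rw [← hεM]
    gcongr
    linarith
  have hcount : p * c * M ≤ ε / 4 := by
    rw [← hεM]
    gcongr
  have hsmall : p * lam i * (ε / 8) ≤ 2 * (ε / 8) := by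
    gcongr
    nlinarith
  linarith
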